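/- arXiv:2210.01722 — 2 statements merged into one kernel-verified Lean document; each statement's English description precedes it below -/
import Mathlib

section
/- Let n ≥ 3 and let f_1, f_2, f_3 be quadratic functions f_i(x) = xᵀA_ix + 2b_iᵀx + c_i on ℝⁿ such that there exists θ ∈ ℝ³ with θ_1Q_1 + θ_2Q_2 + θ_3Q_3 positive definite. Suppose S ≠ ∅ and conv(S) ≠ ℝⁿ. Then there exists a subset Ω' ⊆ Ω with |Ω'| ≤ 6 such that conv(S) = ⋂_{λ∈Ω'} S_λ. -/
open Matrix Set

noncomputable section

/-- The value of the quadratic function `xᵀ A x + 2 bᵀ x + c`. -/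
def qf {n : ℕ} (A : Matrix (Fin n) (Fin n) ℝ) (b : Fin n → ℝ) (c : ℝ) (x : Fin n → ℝ) : ℝ :=
  x ⬝ᵥ A.mulVec x + 2 * (b ⬝ᵥ x) + c

/-- The bordered `(n+1)×(n+1)` matrix `[[A, b], [bᵀ, c]]`. -/
def Qmat {n : ℕ} (A : Matrix (Fin n) (Fin n) ℝ) (b : Fin n → ℝ) (c : ℝ) :
    Matrix (Fin n ⊕ Unit) (Fin n ⊕ Unit) ℝ :=
  Matrix.fromBlocks A (Matrix.of fun i _ => b i) (Matrix.of fun _ j => b j)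
    (Matrix.of fun _ _ => c)

/-- A linear hyperplane: the kernel of a nonzero linear functional. -/
def IsLinearHyperplane {V : Type*} [AddCommGroup V] [Module ℝ V] (H : Submodule ℝ V) : Prop :=
  ∃ φ : V →ₗ[ℝ] ℝ, φ ≠ 0 ∧ H = LinearMap.ker φ

/-- Image of a set under the quadratic map associated to the family `Q`. -/
def quadImage {ι κ : Type*} [Fintype ι] (Q : κ → Matrix ι ι ℝ) (U : Set (ι → ℝ)) :
    Set (κ → ℝ) :=
  (fun x k => x ⬝ᵥ (Q k).mulVec x) '' U

/-- Hidden hyperplane convexity: the image of every linear hyperplane under the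
quadratic map is convex. -/
def HHC {ι κ : Type*} [Fintype ι] (Q : κ → Matrix ι ι ℝ) : Prop :=
  ∀ H : Submodule ℝ (ι → ℝ), IsLinearHyperplane H →
    Convex ℝ (quadImage Q (H : Set (ι → ℝ)))

/-- `Q` has at most one negative eigenvalue, counted with multiplicity. -/
def NegEigsAtMostOne {ι : Type*} [Fintype ι] [DecidableEq ι] (Q : Matrix ι ι ℝ) : Prop :=
  ∃ hQ : Q.IsHermitian, (Finset.univ.filter fun i => hQ.eigenvalues i < 0).card ≤ 1

/-- The set `S` defined by the strict quadratic inequalities. -/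
def Sset {n m : ℕ} (A : Fin m → Matrix (Fin n) (Fin n) ℝ) (b : Fin m → Fin n → ℝ)
    (c : Fin m → ℝ) : Set (Fin n → ℝ) :=
  {x | ∀ i, qf (A i) (b i) (c i) x < 0}

/-- The set defined by the aggregated inequality with weights `lam`. -/
def Sagg {n m : ℕ} (A : Fin m → Matrix (Fin n) (Fin n) ℝ) (b : Fin m → Fin n → ℝ)
    (c : Fin m → ℝ) (lam : Fin m → ℝ) : Set (Fin n → ℝ) :=
  {x | ∑ i, lam i * qf (A i) (b i) (c i) x < 0}

/-- The set `Ω` of good aggregations. -/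
def Omega {n m : ℕ} (A : Fin m → Matrix (Fin n) (Fin n) ℝ) (b : Fin m → Fin n → ℝ)
    (c : Fin m → ℝ) : Set (Fin m → ℝ) :=
  {lam | 0 ≤ lam ∧ lam ≠ 0 ∧ convexHull ℝ (Sset A b c) ⊆ Sagg A b c lam ∧
    NegEigsAtMostOne (∑ i, lam i • Qmat (A i) (b i) (c i))}

section Forms

variable {V : Type*} [AddCommGroup V] [Module ℝ V]

/-- A bilinear form which is nonpositive at `w 0` and nonnegative at `w 1`, for a path `w` in the
span of three vectors, vanishes somewhere on the path. -/
lemma exists_form_eq_zero_on_path (R : LinearMap.BilinForm ℝ V) (x y z : V) {a b c : ℝ → ℝ}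
    (ha : Continuous a) (hb : Continuous b) (hc : Continuous c)
    (h0 : R (a 0 • x + b 0 • y + c 0 • z) (a 0 • x + b 0 • y + c 0 • z) ≤ 0)
    (h1 : 0 ≤ R (a 1 • x + b 1 • y + c 1 • z) (a 1 • x + b 1 • y + c 1 • z)) :
    ∃ t ∈ Icc (0 : ℝ) 1,
      R (a t • x + b t • y + c t • z) (a t • x + b t • y + c t • z) = 0 := by
  have hcont : Continuous fun t =>
      R (a t • x + b t • y + c t • z) (a t • x + b t • y + c t • z) := by
    simp only [map_add, map_smul, LinearMap.add_apply, LinearMap.smul_apply, smul_eq_mul]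
    fun_prop
  obtain ⟨t, ht, htR⟩ := intermediate_value_Icc zero_le_one hcont.continuousOn ⟨h0, h1⟩
  exact ⟨t, ht, htR⟩

/-- In dimension at least three, two isotropic vectors of `P` on which `R` has opposite signs
yield a common isotropic vector of `P` and `R`. -/
lemma exists_common_isotropic [FiniteDimensional ℝ V] (hV : 3 ≤ Module.finrank ℝ V)
    (P R : LinearMap.BilinForm ℝ V) (hP : ∀ u v, P u v = P v u) {x y : V}
    (hx : x ≠ 0) (hy : y ≠ 0) (hPx : P x x = 0) (hPy : P y y = 0)
    (hRx : R x x ≤ 0) (hRy : 0 ≤ R y y) : ∃ w, w ≠ 0 ∧ P w w = 0 ∧ R w w = 0 := by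
  rcases eq_or_ne (P x y) 0 with hxy | hxy
  · obtain ⟨t, ht, hR⟩ := exists_form_eq_zero_on_path R x y 0
      (a := fun t => 1 - t) (b := fun t => t) (c := fun _ => 0)
      (by fun_prop) (by fun_prop) (by fun_prop) (by simpa using hRx) (by simpa using hRy)
    simp only [smul_zero, add_zero] at hR
    by_cases h : (1 - t) • x + t • y = 0
    · rcases eq_or_ne t 0 with rfl | ht0
      · simp [hx] at h
      · refine ⟨y, hy, hPy, ?_⟩
        have h1 : t • y = (-(1 - t)) • x := by
          rw [neg_smul]; exact eq_neg_of_add_eq_zero_right h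
        have h2 : R (t • y) (t • y) = R ((-(1 - t)) • x) ((-(1 - t)) • x) := by rw [h1]
        simp only [map_smul, LinearMap.smul_apply, smul_eq_mul] at h2
        have h3 : 0 < t ^ 2 := by positivity
        nlinarith [sq_nonneg (1 - t)]
    · refine ⟨_, h, ?_, hR⟩
      simp [hPx, hPy, hxy, hP y x]
  · obtain ⟨z, hz, hz0⟩ := Submodule.exists_mem_ne_zero_of_ne_bot
      (LinearMap.ker_ne_bot_of_finrank_lt (f := (P x).prod (P y)) (by simp; omega))
    have hzx : P x z = 0 := congrArg Prod.fst (LinearMap.mem_ker.1 hz)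
    have hzy : P y z = 0 := congrArg Prod.snd (LinearMap.mem_ker.1 hz)
    have hxz : P z x = 0 := by rw [hP, hzx]
    have hyz : P z y = 0 := by rw [hP, hzy]
    have hyx : P y x = P x y := hP y x
    rcases eq_or_ne (P z z) 0 with hd | hd
    · rcases le_total 0 (R z z) with hRz | hRz
      · obtain ⟨t, ht, hR⟩ := exists_form_eq_zero_on_path R x z 0
          (a := fun t => 1 - t) (b := fun t => t) (c := fun _ => 0)
          (by fun_prop) (by fun_prop) (by fun_prop) (by simpa using hRx) (by simpa using hRz)
        refine ⟨_, fun h => ?_, ?_, hR⟩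
        · have h1 : P y ((1 - t) • x + t • z + (0 : ℝ) • 0) = 0 := by rw [h, map_zero]
          have h2 : 1 - t = 0 := by simpa [hzy, hyx, hxy] using h1
          obtain rfl : t = 1 := by linarith
          simp [hz0] at h
        · simp [hPx, hd, hzx, hxz]
      · obtain ⟨t, ht, hR⟩ := exists_form_eq_zero_on_path R z y 0
          (a := fun t => 1 - t) (b := fun t => t) (c := fun _ => 0)
          (by fun_prop) (by fun_prop) (by fun_prop) (by simpa using hRz) (by simpa using hRy)
        refine ⟨_, fun h => ?_, ?_, hR⟩
        · have h1 : P x ((1 - t) • z + t • y + (0 : ℝ) • 0) = 0 := by rw [h, map_zero]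
          obtain rfl : t = 0 := by simpa [hzx, hxy] using h1
          simp [hz0] at h
        · simp [hPy, hd, hzy, hyz]
    · obtain ⟨σ, hσ, hσd⟩ : ∃ σ : ℝ, σ ^ 2 = 1 ∧ 0 ≤ -(2 * (σ * P x y)) / P z z := by
        rcases le_total 0 (-(2 * P x y) / P z z) with h | h
        · exact ⟨1, by norm_num, by simpa using h⟩
        · refine ⟨-1, by norm_num, ?_⟩
          have : -(2 * (-1 * P x y)) / P z z = -(-(2 * P x y) / P z z) := by ring
          rw [this]; linarith
      have hσ0 : σ ≠ 0 := by rintro rfl; norm_num at hσ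
      obtain ⟨t, ht, hR⟩ := exists_form_eq_zero_on_path R x y z
        (a := fun t => 1 - t) (b := fun t => t * σ)
        (c := fun t => √(t * (1 - t) * (-(2 * (σ * P x y)) / P z z)))
        (by fun_prop) (by fun_prop) (by fun_prop) (by simpa using hRx)
        (by simpa [← mul_assoc, ← sq, hσ] using hRy)
      have hs := Real.mul_self_sqrt
        (mul_nonneg (mul_nonneg ht.1 (sub_nonneg.2 ht.2)) hσd)
      set s := √(t * (1 - t) * (-(2 * (σ * P x y)) / P z z))
      refine ⟨_, fun h => ?_, ?_, hR⟩
      · have h1 : P x ((1 - t) • x + (t * σ) • y + s • z) = 0 := by rw [h, map_zero]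
        have h2 : P y ((1 - t) • x + (t * σ) • y + s • z) = 0 := by rw [h, map_zero]
        have h3 : t = 0 := by simpa [hPx, hzx, hxy, hσ0] using h1
        have h4 : 1 - t = 0 := by simpa [hPy, hzy, hyx, hxy] using h2
        linarith
      · have h1 : s * s * P z z = -(2 * (t * (1 - t) * σ * P x y)) := by
          rw [hs]; field_simp
        simp only [map_add, map_smul, LinearMap.add_apply, LinearMap.smul_apply, smul_eq_mul,
          hPx, hPy, hzx, hzy, hxz, hyz, hyx]
        linear_combination h1

/-- **Convexity of the joint numerical range** of three quadratic forms having a positive definite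
linear combination, in dimension at least three. -/
lemma convex_range_three_forms [FiniteDimensional ℝ V] (hV : 3 ≤ Module.finrank ℝ V)
    (B : Fin 3 → LinearMap.BilinForm ℝ V) (hB : ∀ i u v, B i u v = B i v u) {θ : Fin 3 → ℝ}
    (hθ : ∀ v, v ≠ 0 → 0 < ∑ i, θ i * B i v v) :
    Convex ℝ (Set.range fun v i => B i v v) := by
  set q : V → Fin 3 → ℝ := fun v i => B i v v with hq
  have hsmul : ∀ (r : ℝ) v, 0 ≤ r → r • q v ∈ Set.range q := by
    intro r v hr
    refine ⟨√r • v, funext fun i => ?_⟩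
    simp only [hq, map_smul, LinearMap.smul_apply, smul_eq_mul, Pi.smul_apply]
    rw [← mul_assoc, Real.mul_self_sqrt hr]
  have hadd : ∀ x y, q x + q y ∈ Set.range q := by
    intro x y
    rcases eq_or_ne x 0 with rfl | hx
    · exact ⟨y, by ext i; simp [hq]⟩
    rcases eq_or_ne y 0 with rfl | hy
    · exact ⟨x, by ext i; simp [hq]⟩
    set u := q x with hu
    set v := q y with hv
    have hθu : 0 < θ ⬝ᵥ u := hθ x hx
    have hθv : 0 < θ ⬝ᵥ v := hθ y hy
    by_cases hl : u ⨯₃ v = 0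
    · have hvu : v = ((θ ⬝ᵥ v) / (θ ⬝ᵥ u)) • u := by
        have h0 := congrFun hl 0
        have h1 := congrFun hl 1
        have h2 := congrFun hl 2
        simp only [cross_apply, Matrix.cons_val, Pi.zero_apply] at h0 h1 h2
        rw [div_eq_inv_mul, mul_smul, eq_inv_smul_iff₀ hθu.ne']
        ext i
        fin_cases i <;> simp [dotProduct, Fin.sum_univ_three]
        · linear_combination (-θ 1) * h2 + θ 2 * h1
        · linear_combination (θ 0) * h2 - θ 2 * h0
        · linear_combination (-θ 0) * h1 + θ 1 * h0
      have : u + v = (1 + (θ ⬝ᵥ v) / (θ ⬝ᵥ u)) • q x := by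
        rw [add_smul, one_smul, ← hu, ← hvu]
      rw [this]
      exact hsmul _ _ (by positivity)
    · set l := u ⨯₃ v with hldef
      set m := (u + v) ⨯₃ l with hmdef
      have hform : ∀ (a : Fin 3 → ℝ) w, (∑ i, a i • B i) w w = a ⬝ᵥ q w := by
        intro a w
        simp [dotProduct, hq, LinearMap.sum_apply]
      have hlu : l ⬝ᵥ u = 0 := by rw [dotProduct_comm]; exact dot_self_cross u v
      have hlv : l ⬝ᵥ v = 0 := by rw [dotProduct_comm]; exact dot_cross_self u v
      have hmuv : m ⬝ᵥ u + m ⬝ᵥ v = 0 := by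
        rw [← dotProduct_add, dotProduct_comm]; exact dot_self_cross _ _
      obtain ⟨w, hw, hlw, hmw⟩ : ∃ w, w ≠ 0 ∧ l ⬝ᵥ q w = 0 ∧ m ⬝ᵥ q w = 0 := by
        simp only [← hform]
        have hsym : ∀ a b, (∑ i, l i • B i) a b = (∑ i, l i • B i) b a := by
          intro a b
          simp only [LinearMap.sum_apply, LinearMap.smul_apply, hB _ a b]
        rcases le_total (m ⬝ᵥ u) 0 with h | h
        · exact exists_common_isotropic hV _ _ hsym hx hy (by rw [hform]; exact hlu)
            (by rw [hform]; exact hlv) (by rw [hform]; exact h)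
            (by rw [hform]; linarith)
        · exact exists_common_isotropic hV _ _ hsym hy hx (by rw [hform]; exact hlv)
            (by rw [hform]; exact hlu) (by rw [hform]; linarith)
            (by rw [hform]; exact h)
      have hll : 0 < l ⬝ᵥ l := by
        refine lt_of_le_of_ne (Finset.sum_nonneg fun i _ => mul_self_nonneg _) fun h => hl ?_
        exact dotProduct_self_eq_zero.1 h.symm
      have hpar : ∀ g a : Fin 3 → ℝ, l ⬝ᵥ g = 0 → l ⬝ᵥ a = 0 → (g ⨯₃ l) ⬝ᵥ a = 0 →
          ∀ i j, a i * g j = a j * g i := by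
        intro g a h1 h2 h3
        have hag : a ⨯₃ g = 0 := by
          have h : (l ⬝ᵥ l) • (a ⨯₃ g) = ((g ⨯₃ l) ⬝ᵥ a) • l - (l ⬝ᵥ a) • (g ⨯₃ l)
              + (l ⬝ᵥ g) • (a ⨯₃ l) := by
            ext k
            fin_cases k <;>
              simp [cross_apply, dotProduct, Fin.sum_univ_three, vecHead, vecTail] <;> ring
          rw [h1, h2, h3] at h
          simpa [hll.ne'] using h
        have h0 := congrFun hag 0
        have h1 := congrFun hag 1
        have h2 := congrFun hag 2
        simp only [cross_apply, Matrix.cons_val, Pi.zero_apply] at h0 h1 h2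
        intro i j
        fin_cases i <;> fin_cases j <;> simp <;> linarith
      have hgw := hpar (u + v) (q w) (by rw [dotProduct_add, hlu, hlv, add_zero]) hlw hmw
      have hθw : 0 < θ ⬝ᵥ q w := hθ w hw
      have hθg : 0 < θ ⬝ᵥ (u + v) := by rw [dotProduct_add]; positivity
      have : u + v = ((θ ⬝ᵥ (u + v)) / (θ ⬝ᵥ q w)) • q w := by
        rw [div_eq_inv_mul, mul_smul, eq_inv_smul_iff₀ hθw.ne']
        ext j
        simp only [dotProduct, Pi.smul_apply, smul_eq_mul, Finset.sum_mul, mul_assoc, hgw _ j]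
        exact Finset.sum_congr rfl fun i _ => by rw [mul_comm (q w j)]
      rw [this]
      exact hsmul _ _ (by positivity)
  rintro _ ⟨x, rfl⟩ _ ⟨y, rfl⟩ a b ha hb -
  obtain ⟨x', hx'⟩ := hsmul a x ha
  obtain ⟨y', hy'⟩ := hsmul b y hb
  rw [← hx', ← hy']
  exact hadd x' y'

/-- **S-lemma** for three quadratic forms having a positive definite linear combination. -/
lemma exists_nonneg_aggregation [FiniteDimensional ℝ V] (hV : 3 ≤ Module.finrank ℝ V)
    (B : Fin 3 → LinearMap.BilinForm ℝ V) (hB : ∀ i u v, B i u v = B i v u) {θ : Fin 3 → ℝ}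
    (hθ : ∀ v, v ≠ 0 → 0 < ∑ i, θ i * B i v v) (hneg : ∀ v, ¬ ∀ i, B i v v < 0) :
    ∃ l : Fin 3 → ℝ, 0 ≤ l ∧ l ≠ 0 ∧ ∀ v, 0 ≤ ∑ i, l i * B i v v := by
  set q : V → Fin 3 → ℝ := fun v i => B i v v with hq
  have hset : {x : Fin 3 → ℝ | ∀ i, x i < 0} = Set.univ.pi fun _ => Set.Iio 0 := by
    ext; simp
  have hconv : Convex ℝ {x : Fin 3 → ℝ | ∀ i, x i < 0} := by
    rw [hset]; exact convex_pi fun _ _ => convex_Iio 0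
  have hopen : IsOpen {x : Fin 3 → ℝ | ∀ i, x i < 0} := by
    rw [hset]; exact isOpen_set_pi Set.finite_univ fun _ _ => isOpen_Iio
  obtain ⟨f, u, hf, hu⟩ := geometric_hahn_banach_open hconv hopen
    (convex_range_three_forms hV B hB hθ) (by
      rw [Set.disjoint_left]
      rintro _ hx ⟨v, rfl⟩
      exact hneg v hx)
  have hfsum : ∀ x, f x = ∑ i, f (Pi.single i 1) * x i := by
    intro x
    have h := LinearMap.pi_apply_eq_sum_univ f.toLinearMap x
    simp only [ContinuousLinearMap.coe_coe, smul_eq_mul] at h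
    rw [h]
    exact Finset.sum_congr rfl fun i _ => by
      rw [mul_comm]; congr 2; ext j; simp [Pi.single_apply, eq_comm]
  have hu0 : u ≤ 0 := (hu 0 ⟨0, by ext; simp⟩).trans_eq (map_zero f)
  refine ⟨fun i => f (Pi.single i 1), fun i => ?_, fun h => ?_, fun v => ?_⟩
  · by_contra! h
    simp only [Pi.zero_apply] at h
    set M := |f 1| / -f (Pi.single i 1) with hM
    have hM0 : 0 ≤ M := div_nonneg (abs_nonneg _) (by linarith)
    have h1 := hf (-(M • Pi.single i 1) - 1) fun j => by
      have : 0 ≤ M * (Pi.single i 1 : Fin 3 → ℝ) j :=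
        mul_nonneg hM0 (by rw [Pi.single_apply]; split_ifs <;> norm_num)
      simp only [Pi.sub_apply, Pi.neg_apply, Pi.smul_apply, smul_eq_mul, Pi.one_apply]
      linarith
    rw [map_sub, map_neg, map_smul, smul_eq_mul] at h1
    have h2 : M * f (Pi.single i 1) = -|f 1| := by
      rw [hM, div_neg, neg_mul, div_mul_cancel₀ _ h.ne]
    linarith [le_abs_self (f 1)]
  · have h1 := hf (-1) fun j => by simp
    have h2 : ∀ i, f (Pi.single i 1) = 0 := fun i => congrFun h i
    rw [hfsum] at h1
    simp only [h2, zero_mul, Finset.sum_const_zero] at h1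
    linarith
  · have h2 : f (q v) = ∑ i, f (Pi.single i 1) * B i v v := hfsum _
    change 0 ≤ ∑ i, f (Pi.single i 1) * B i v v
    rw [← h2]
    by_contra! h
    have hr : 0 ≤ u / f (q v) + 1 := by
      have := div_nonneg_of_nonpos hu0 h.le
      linarith
    have h3 : q (√(u / f (q v) + 1) • v) = (u / f (q v) + 1) • q v := by
      ext i
      simp only [map_smul, LinearMap.smul_apply, smul_eq_mul, Pi.smul_apply, hq]
      rw [← mul_assoc, Real.mul_self_sqrt hr]
    have h1 : u ≤ f (q (√(u / f (q v) + 1) • v)) := hu _ ⟨_, rfl⟩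
    rw [h3, map_smul, smul_eq_mul, add_mul, div_mul_cancel₀ _ h.ne] at h1
    linarith

/-- A symmetric form that is nonnegative on a hyperplane satisfies the reversed Cauchy–Schwarz
inequality. -/
lemma reverse_cauchy_schwarz {Q : LinearMap.BilinForm ℝ V} (hQ : ∀ u v, Q u v = Q v u)
    {φ : V →ₗ[ℝ] ℝ} (h : ∀ v, φ v = 0 → 0 ≤ Q v v) {u v : V} (hu : Q u u < 0) :
    Q u u * Q v v ≤ Q u v ^ 2 := by
  have hφu : φ u ≠ 0 := fun h0 => (h u h0).not_gt hu
  have h1 := h (φ v • u - φ u • v) (by simp [mul_comm])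
  simp only [map_sub, map_smul, LinearMap.sub_apply, LinearMap.smul_apply, smul_eq_mul,
    hQ v u] at h1
  have h2 : 0 < φ u ^ 2 := by positivity
  refine le_of_mul_le_mul_left ?_ h2
  nlinarith [sq_nonneg (φ v * Q u u - φ u * Q u v), mul_nonneg h1 (neg_nonneg.2 hu.le)]

/-- Two negative vectors on the same side of a hyperplane on which the form is nonnegative pair
negatively. -/
lemma neg_of_same_side {Q : LinearMap.BilinForm ℝ V} (hQ : ∀ u v, Q u v = Q v u)
    {φ : V →ₗ[ℝ] ℝ} (h : ∀ v, φ v = 0 → 0 ≤ Q v v) {u v : V} (hu : Q u u < 0) (hv : Q v v < 0)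
    (hφu : φ u < 0) (hφv : φ v < 0) : Q u v < 0 := by
  have h1 := h (φ v • u - φ u • v) (by simp [mul_comm])
  simp only [map_sub, map_smul, LinearMap.sub_apply, LinearMap.smul_apply, smul_eq_mul,
    hQ v u] at h1
  have h2 : 0 < φ u * φ v := mul_pos_of_neg_of_neg hφu hφv
  have h3 : φ u ^ 2 * Q v v < 0 := mul_neg_of_pos_of_neg (sq_pos_of_neg hφu) hv
  have h4 : φ v ^ 2 * Q u u < 0 := mul_neg_of_pos_of_neg (sq_pos_of_neg hφv) hu
  by_contra! h5
  nlinarith [mul_nonneg h2.le h5]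

/-- Under the reversed Cauchy–Schwarz inequality, two vectors spanning a segment of negative
vectors pair nonpositively. -/
lemma nonpos_of_segment_neg {Q : LinearMap.BilinForm ℝ V} (hQ : ∀ u v, Q u v = Q v u) {u v : V}
    (hcs : Q u u * Q v v ≤ Q u v ^ 2) (hu : Q u u < 0)
    (hseg : ∀ s t : ℝ, 0 < s → 0 < t → Q (s • u + t • v) (s • u + t • v) < 0) : Q u v ≤ 0 := by
  by_contra! h
  have h1 := hseg (Q u v) (-Q u u) h (by linarith)
  simp only [map_add, map_smul, LinearMap.add_apply, LinearMap.smul_apply, smul_eq_mul,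
    hQ v u] at h1
  nlinarith [mul_nonneg (neg_nonneg.2 hu.le) (sub_nonneg.2 hcs)]

end Forms

/-- A real symmetric matrix has at most one negative eigenvalue if and only if its form satisfies
the reversed Cauchy–Schwarz inequality. -/
lemma negEigsAtMostOne_iff {ι : Type*} [Fintype ι] [DecidableEq ι] [Nonempty ι]
    {M : Matrix ι ι ℝ} (hM : M.IsHermitian) :
    NegEigsAtMostOne M ↔ ∀ u v, M.toBilin' u u < 0 →
      M.toBilin' u u * M.toBilin' v v ≤ M.toBilin' u v ^ 2 := by
  have hsymm : ∀ u v, M.toBilin' u v = M.toBilin' v u := by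
    intro u v
    rw [toBilin'_apply', toBilin'_apply', dotProduct_mulVec, dotProduct_comm, ← mulVec_transpose]
    congr 2
  have heig : ∀ (v : ι → ℝ) i, M.toBilin' v (hM.eigenvectorBasis i).ofLp
      = hM.eigenvalues i * (v ⬝ᵥ (hM.eigenvectorBasis i).ofLp) := by
    intro v i
    rw [toBilin'_apply', hM.mulVec_eigenvectorBasis, dotProduct_smul, smul_eq_mul]
  have hortho : ∀ i j, (hM.eigenvectorBasis i).ofLp ⬝ᵥ (hM.eigenvectorBasis j).ofLp
      = if j = i then 1 else 0 := by
    intro i j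
    have := orthonormal_iff_ite.1 hM.eigenvectorBasis.orthonormal j i
    rw [← this, EuclideanSpace.inner_eq_star_dotProduct]
    simp
  constructor
  · rintro ⟨_, hcard⟩
    obtain ⟨i₀, hi₀⟩ := Finset.card_le_one_iff_subset_singleton.1 hcard
    have hdecomp : ∀ v : ι → ℝ, M.toBilin' v v
        = ∑ i, hM.eigenvalues i * (v ⬝ᵥ (hM.eigenvectorBasis i).ofLp) ^ 2 := by
      intro v
      have h1 := hM.eigenvectorBasis.sum_repr (WithLp.toLp 2 v)
      have h2 : v = ∑ i, (v ⬝ᵥ (hM.eigenvectorBasis i).ofLp) • (hM.eigenvectorBasis i).ofLp := by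
        have h3 := congrArg WithLp.ofLp h1
        simp only [WithLp.ofLp_sum, WithLp.ofLp_smul] at h3
        conv_lhs => rw [← h3]
        refine Finset.sum_congr rfl fun i _ => ?_
        rw [OrthonormalBasis.repr_apply_apply, EuclideanSpace.inner_eq_star_dotProduct]
        simp
      conv_lhs => rw [h2]
      rw [map_sum]
      refine Finset.sum_congr rfl fun i _ => ?_
      rw [← h2, map_smul, heig, smul_eq_mul]
      ring
    intro u v hu
    refine reverse_cauchy_schwarz (φ := dotProductBilin ℝ ℝ (hM.eigenvectorBasis i₀).ofLp) hsymm
      (fun w hw => ?_) hu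
    rw [hdecomp]
    refine Finset.sum_nonneg fun i _ => ?_
    by_cases hi : hM.eigenvalues i < 0
    · obtain rfl : i = i₀ := by simpa using hi₀ (by simpa using hi)
      have hw' : (hM.eigenvectorBasis i).ofLp ⬝ᵥ w = 0 := hw
      rw [dotProduct_comm, hw']
      simp
    · exact mul_nonneg (not_lt.1 hi) (sq_nonneg _)
  · intro h
    refine ⟨hM, Finset.card_le_one.2 fun i hi j hj => ?_⟩
    by_contra hij
    simp only [Finset.mem_filter_univ] at hi hj
    have := h (hM.eigenvectorBasis i).ofLp (hM.eigenvectorBasis j).ofLp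
    simp only [heig, hortho, if_true, Ne.symm hij, if_false, mul_one, mul_zero] at this
    nlinarith [this hi, mul_pos_of_neg_of_neg hi hj]

/-- The point `(x, 1)` of the homogenized space. -/
def homog {n : ℕ} (x : Fin n → ℝ) : Fin n ⊕ Unit → ℝ := Sum.elim x fun _ => 1

lemma homog_comb {n : ℕ} {x y : Fin n → ℝ} {s t : ℝ} (h : s + t = 1) :
    homog (s • x + t • y) = s • homog x + t • homog y := by
  ext i
  cases i <;> simp [homog, h]

lemma toBilin'_Qmat_homog {n : ℕ} (A : Matrix (Fin n) (Fin n) ℝ) (b : Fin n → ℝ) (c : ℝ)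
    (x : Fin n → ℝ) : (Qmat A b c).toBilin' (homog x) (homog x) = qf A b c x := by
  rw [toBilin'_apply']
  simp only [Qmat, qf, homog, fromBlocks_mulVec, sumElim_dotProduct_sumElim, Sum.elim_comp_inl,
    Sum.elim_comp_inr]
  have h1 : (Matrix.of fun i _ => b i : Matrix (Fin n) Unit ℝ) *ᵥ (fun _ => (1 : ℝ)) = b := by
    ext i; simp [mulVec, dotProduct]
  have h2 : (Matrix.of fun _ j => b j : Matrix Unit (Fin n) ℝ) *ᵥ x = fun _ => b ⬝ᵥ x := by
    ext i; simp [mulVec, dotProduct]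
  rw [h1, h2, dotProduct_add, dotProduct_comm x b]
  simp [dotProduct, mulVec]
  ring

lemma isHermitian_Qmat {n : ℕ} {A : Matrix (Fin n) (Fin n) ℝ} (hA : A.IsSymm) (b : Fin n → ℝ)
    (c : ℝ) : (Qmat A b c).IsHermitian := by
  ext i j
  rcases i with i | i <;> rcases j with j | j <;> simp [Qmat, hA.apply]

lemma isHermitian_sum_smul_Qmat {n m : ℕ} {A : Fin m → Matrix (Fin n) (Fin n) ℝ}
    (hA : ∀ i, (A i).IsSymm) (b : Fin m → Fin n → ℝ) (c lam : Fin m → ℝ) :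
    (∑ i, lam i • Qmat (A i) (b i) (c i)).IsHermitian := by
  rw [Matrix.IsHermitian, conjTranspose_sum]
  exact Finset.sum_congr rfl fun i _ => by
    rw [conjTranspose_smul, (isHermitian_Qmat (hA i) _ _).eq, star_trivial]

/-- The bilinear form of the aggregated matrix `∑ i, lam i • Q i`. -/
def aggForm {n m : ℕ} (A : Fin m → Matrix (Fin n) (Fin n) ℝ) (b : Fin m → Fin n → ℝ)
    (c : Fin m → ℝ) (lam : Fin m → ℝ) : LinearMap.BilinForm ℝ (Fin n ⊕ Unit → ℝ) :=
  (∑ i, lam i • Qmat (A i) (b i) (c i)).toBilin'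

section Aggregation

variable {n m : ℕ} {A : Fin m → Matrix (Fin n) (Fin n) ℝ} {b : Fin m → Fin n → ℝ}
  {c : Fin m → ℝ} {lam : Fin m → ℝ}

lemma aggForm_apply (u v : Fin n ⊕ Unit → ℝ) :
    aggForm A b c lam u v = ∑ i, lam i * (Qmat (A i) (b i) (c i)).toBilin' u v := by
  simp [aggForm, map_sum, LinearMap.sum_apply]

lemma aggForm_smul (r : ℝ) (u v : Fin n ⊕ Unit → ℝ) :
    aggForm A b c (r • lam) u v = r * aggForm A b c lam u v := by
  simp [aggForm_apply, Finset.mul_sum, mul_assoc]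

lemma aggForm_comm (hA : ∀ i, (A i).IsSymm) (u v : Fin n ⊕ Unit → ℝ) :
    aggForm A b c lam u v = aggForm A b c lam v u := by
  rw [aggForm, toBilin'_apply', toBilin'_apply', dotProduct_mulVec, dotProduct_comm,
    ← mulVec_transpose]
  congr 2
  exact isHermitian_sum_smul_Qmat hA b c lam

lemma continuous_aggForm (u v : Fin n ⊕ Unit → ℝ) :
    Continuous fun lam => aggForm A b c lam u v := by
  simp only [aggForm_apply]
  fun_prop

lemma mem_Sagg_iff {x : Fin n → ℝ} :
    x ∈ Sagg A b c lam ↔ aggForm A b c lam (homog x) (homog x) < 0 := by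
  simp [aggForm_apply, toBilin'_Qmat_homog, Sagg]

lemma Sset_subset_Sagg (h0 : 0 ≤ lam) (hne : lam ≠ 0) : Sset A b c ⊆ Sagg A b c lam := by
  intro x hx
  obtain ⟨i, hi⟩ := Function.ne_iff.1 hne
  refine Finset.sum_neg' (fun j _ => mul_nonpos_of_nonneg_of_nonpos (h0 j) (hx j).le)
    ⟨i, Finset.mem_univ _, mul_neg_of_pos_of_neg (lt_of_le_of_ne (h0 i) (Ne.symm hi)) (hx i)⟩

lemma Sagg_inter_subset {l₁ l₂ : Fin m → ℝ} {s t : ℝ} (hs : 0 ≤ s) (ht : 0 ≤ t)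
    (hst : s + t = 1) : Sagg A b c l₁ ∩ Sagg A b c l₂ ⊆ Sagg A b c (s • l₁ + t • l₂) := by
  rintro x ⟨h1, h2⟩
  have h3 := convex_Iio (𝕜 := ℝ) (0 : ℝ) h1 h2 hs ht hst
  simpa [Sagg, add_mul, Finset.sum_add_distrib, Finset.mul_sum, mul_assoc] using h3

/-- Aggregations in `Ω` are described by conditions that are closed in the weights. -/
lemma mem_Omega_iff (hA : ∀ i, (A i).IsSymm) :
    lam ∈ Omega A b c ↔ 0 ≤ lam ∧ lam ≠ 0 ∧
      (∀ x ∈ Sset A b c, ∀ y ∈ Sset A b c, aggForm A b c lam (homog x) (homog y) ≤ 0) ∧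
      ∀ u v, aggForm A b c lam u u < 0 →
        aggForm A b c lam u u * aggForm A b c lam v v ≤ aggForm A b c lam u v ^ 2 := by
  have hcomm := aggForm_comm (b := b) (c := c) (lam := lam) hA
  rw [Omega, Set.mem_ofPred_eq, negEigsAtMostOne_iff (isHermitian_sum_smul_Qmat hA b c lam)]
  refine and_congr_right fun h0 => and_congr_right fun hne => and_congr_left fun hcs => ?_
  constructor
  · intro hsub x hx y hy
    refine nonpos_of_segment_neg hcomm (hcs _ _ ?_) ?_ fun s t hs ht => ?_
    · exact mem_Sagg_iff.1 (Sset_subset_Sagg h0 hne hx)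
    · exact mem_Sagg_iff.1 (Sset_subset_Sagg h0 hne hx)
    · have hst : 0 < s + t := by positivity
      have h1 : s / (s + t) + t / (s + t) = 1 := by field_simp
      have h2 := mem_Sagg_iff.1 (hsub ((convex_convexHull ℝ (Sset A b c))
        (subset_convexHull ℝ _ hx) (subset_convexHull ℝ _ hy)
        (by positivity) (by positivity) h1))
      rw [homog_comb h1] at h2
      have h3 : s • homog x + t • homog y
          = (s + t) • ((s / (s + t)) • homog x + (t / (s + t)) • homog y) := by
        rw [smul_add, smul_smul, smul_smul, mul_div_cancel₀ _ hst.ne', mul_div_cancel₀ _ hst.ne']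
      rw [h3]
      simp only [map_smul, LinearMap.smul_apply, smul_eq_mul] at h2 ⊢
      exact mul_neg_of_pos_of_neg hst (mul_neg_of_pos_of_neg hst h2)
  · intro hpair
    have hconv : ∀ w, Convex ℝ {z : Fin n → ℝ | aggForm A b c lam (homog z) w ≤ 0} := by
      intro w z₁ h1 z₂ h2 s t hs ht hst
      simp only [Set.mem_ofPred_eq, homog_comb hst, map_add, map_smul, LinearMap.add_apply,
        LinearMap.smul_apply, smul_eq_mul] at h1 h2 ⊢
      linarith [mul_nonpos_of_nonneg_of_nonpos hs h1, mul_nonpos_of_nonneg_of_nonpos ht h2]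
    have h1 : ∀ x ∈ Sset A b c, ∀ z ∈ convexHull ℝ (Sset A b c),
        aggForm A b c lam (homog z) (homog x) ≤ 0 := fun x hx =>
      convexHull_min (fun z hz => hpair z hz x hx) (hconv (homog x))
    have h2 : ∀ z ∈ convexHull ℝ (Sset A b c), ∀ w ∈ convexHull ℝ (Sset A b c),
        aggForm A b c lam (homog w) (homog z) ≤ 0 := fun z hz =>
      convexHull_min (fun x hx => (hcomm _ _).trans_le (h1 x hx z hz)) (hconv (homog z))
    have h3 : Convex ℝ (convexHull ℝ (Sset A b c) ∩ Sagg A b c lam) := by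
      rintro z ⟨hz, hz'⟩ w ⟨hw, hw'⟩ s t hs ht hst
      refine ⟨convex_convexHull ℝ _ hz hw hs ht hst, ?_⟩
      rw [mem_Sagg_iff] at hz' hw' ⊢
      have hzw := h2 _ hw _ hz
      simp only [homog_comb hst, map_add, map_smul, LinearMap.add_apply,
        LinearMap.smul_apply, smul_eq_mul, hcomm (homog w) (homog z)]
      rcases hs.eq_or_lt with rfl | hs
      · obtain rfl : t = 1 := by linarith
        linarith
      · have h4 : s * (s * aggForm A b c lam (homog z) (homog z)) < 0 :=
          mul_neg_of_pos_of_neg hs (mul_neg_of_pos_of_neg hs hz')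
        have h5 : t * (t * aggForm A b c lam (homog w) (homog w)) ≤ 0 :=
          mul_nonpos_of_nonneg_of_nonpos ht (mul_nonpos_of_nonneg_of_nonpos ht hw'.le)
        have h6 : s * (t * aggForm A b c lam (homog z) (homog w)) ≤ 0 :=
          mul_nonpos_of_nonneg_of_nonpos hs.le (mul_nonpos_of_nonneg_of_nonpos ht hzw)
        linarith
    have h4 : Sset A b c ⊆ convexHull ℝ (Sset A b c) ∩ Sagg A b c lam := fun x hx =>
      ⟨subset_convexHull ℝ _ hx, Sset_subset_Sagg h0 hne hx⟩
    exact fun z hz => (convexHull_min h4 h3 hz).2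

lemma smul_mem_Omega (hA : ∀ i, (A i).IsSymm) (h : lam ∈ Omega A b c) {r : ℝ} (hr : 0 < r) :
    r • lam ∈ Omega A b c := by
  rw [mem_Omega_iff hA] at h ⊢
  obtain ⟨h0, hne, hpair, hcs⟩ := h
  refine ⟨smul_nonneg hr.le h0, smul_ne_zero hr.ne' hne, fun x hx y hy => ?_, fun u v hu => ?_⟩
  · rw [aggForm_smul]
    exact mul_nonpos_of_nonneg_of_nonpos hr.le (hpair x hx y hy)
  · simp only [aggForm_smul] at hu ⊢
    nlinarith [mul_le_mul_of_nonneg_left (hcs u v (neg_of_mul_neg_right hu hr.le)) (sq_nonneg r)]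

/-- A nonnegative aggregation whose form is nonnegative on a hyperplane strictly on one side of
`S` belongs to `Ω`. -/
lemma mem_Omega_of_hyperplane (hA : ∀ i, (A i).IsSymm) (h0 : 0 ≤ lam) (hne : lam ≠ 0)
    {φ : (Fin n ⊕ Unit → ℝ) →ₗ[ℝ] ℝ} (hφ : ∀ x ∈ Sset A b c, φ (homog x) < 0)
    (h : ∀ v, φ v = 0 → 0 ≤ aggForm A b c lam v v) : lam ∈ Omega A b c := by
  have hS : ∀ x ∈ Sset A b c, aggForm A b c lam (homog x) (homog x) < 0 := fun x hx =>
    mem_Sagg_iff.1 (Sset_subset_Sagg h0 hne hx)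
  refine (mem_Omega_iff hA).2 ⟨h0, hne, fun x hx y hy => ?_, fun u v hu => ?_⟩
  · exact (neg_of_same_side (aggForm_comm hA) h (hS x hx) (hS y hy) (hφ x hx) (hφ y hy)).le
  · exact reverse_cauchy_schwarz (aggForm_comm hA) h hu

/-- The normalized aggregations of `Ω` with a vanishing weight form a compact set. -/
lemma isCompact_Omega_facet (hA : ∀ i, (A i).IsSymm) (i : Fin m) :
    IsCompact {l | l ∈ Omega A b c ∧ l i = 0 ∧ ∑ j, l j = 1} := by
  have heq : {l | l ∈ Omega A b c ∧ l i = 0 ∧ ∑ j, l j = 1} =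
      stdSimplex ℝ (Fin m) ∩ {l | l i = 0 ∧
        (∀ x ∈ Sset A b c, ∀ y ∈ Sset A b c, aggForm A b c l (homog x) (homog y) ≤ 0) ∧
        ∀ u v, aggForm A b c l u u < 0 →
          aggForm A b c l u u * aggForm A b c l v v ≤ aggForm A b c l u v ^ 2} := by
    ext l
    simp only [Set.mem_ofPred_eq, Set.mem_inter_iff, stdSimplex, mem_Omega_iff hA]
    constructor
    · rintro ⟨⟨h0, -, h1, h2⟩, h3, h4⟩
      exact ⟨⟨h0, h4⟩, h3, h1, h2⟩
    · rintro ⟨⟨h0, h4⟩, h3, h1, h2⟩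
      exact ⟨⟨h0, by rintro rfl; simp at h4, h1, h2⟩, h3, h4⟩
  have h1 : IsClosed {l | ∀ x ∈ Sset A b c, ∀ y ∈ Sset A b c,
      aggForm A b c l (homog x) (homog y) ≤ 0} := by
    simp only [Set.ofPred_forall]
    exact isClosed_iInter fun x => isClosed_iInter fun _ => isClosed_iInter fun y =>
      isClosed_iInter fun _ => isClosed_le (continuous_aggForm _ _) continuous_const
  have h2 : IsClosed {l | ∀ u v, aggForm A b c l u u < 0 →
      aggForm A b c l u u * aggForm A b c l v v ≤ aggForm A b c l u v ^ 2} := by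
    simp only [Set.ofPred_forall]
    exact isClosed_iInter fun u => isClosed_iInter fun v => isClosed_imp
      (isOpen_lt (continuous_aggForm _ _) continuous_const)
      (isClosed_le ((continuous_aggForm _ _).mul (continuous_aggForm _ _))
        ((continuous_aggForm _ _).pow 2))
  rw [heq]
  exact (isCompact_stdSimplex ℝ (Fin m)).inter_right
    ((isClosed_eq (continuous_apply i) continuous_const).inter (h1.inter h2))

end Aggregation

lemma isOpen_Sset {n m : ℕ} (A : Fin m → Matrix (Fin n) (Fin n) ℝ) (b : Fin m → Fin n → ℝ)
    (c : Fin m → ℝ) : IsOpen (Sset A b c) := by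
  simp only [Sset, Set.ofPred_forall]
  have hqf : ∀ i, Continuous fun x => qf (A i) (b i) (c i) x := fun i => by
    simp only [qf, dotProduct, mulVec]
    fun_prop
  exact isOpen_iInter_of_finite fun i => isOpen_lt (hqf i) continuous_const

/-- Two aggregations of `Ω` supported on a facet of the orthant dominate all the others. -/
lemma exists_pair_dominating_facet {n : ℕ} {A : Fin 3 → Matrix (Fin n) (Fin n) ℝ}
    {b : Fin 3 → Fin n → ℝ} {c : Fin 3 → ℝ} (hA : ∀ i, (A i).IsSymm) (i : Fin 3) :
    ∃ l₁ l₂ : Fin 3 → ℝ, ∀ lam ∈ Omega A b c, lam i = 0 →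
      l₁ ∈ Omega A b c ∧ l₂ ∈ Omega A b c ∧
        Sagg A b c l₁ ∩ Sagg A b c l₂ ⊆ Sagg A b c lam := by
  set K := {l | l ∈ Omega A b c ∧ l i = 0 ∧ ∑ j, l j = 1}
  have hnorm : ∀ lam ∈ Omega A b c, lam i = 0 → 0 < ∑ j, lam j ∧ (∑ j, lam j)⁻¹ • lam ∈ K := by
    intro lam hlam hi
    have hpos : 0 < ∑ j, lam j := by
      obtain ⟨j, hj⟩ := Function.ne_iff.1 hlam.2.1
      exact Finset.sum_pos' (fun k _ => hlam.1 k)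
        ⟨j, Finset.mem_univ _, lt_of_le_of_ne (hlam.1 j) (Ne.symm hj)⟩
    refine ⟨hpos, smul_mem_Omega hA hlam (inv_pos.2 hpos), by simp [hi], ?_⟩
    simp only [Pi.smul_apply, smul_eq_mul, ← Finset.mul_sum]
    exact inv_mul_cancel₀ hpos.ne'
  rcases K.eq_empty_or_nonempty with hK | hK
  · exact ⟨0, 0, fun lam hlam hi =>
      (Set.notMem_empty _ (hK ▸ (hnorm lam hlam hi).2)).elim⟩
  obtain ⟨j, k, hsum, hcover⟩ : ∃ j k : Fin 3, (∀ l : Fin 3 → ℝ, ∑ p, l p = l i + l j + l k) ∧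
      ∀ p, p = i ∨ p = j ∨ p = k := by
    fin_cases i
    · exact ⟨1, 2, fun l => by simp [Fin.sum_univ_three], by decide⟩
    · exact ⟨0, 2, fun l => by simp [Fin.sum_univ_three]; ring, by decide⟩
    · exact ⟨0, 1, fun l => by simp [Fin.sum_univ_three]; ring, by decide⟩
  have hKc : IsCompact K := isCompact_Omega_facet hA i
  obtain ⟨l₁, hl₁, hmin⟩ := hKc.exists_isMinOn hK (continuous_apply j).continuousOn
  obtain ⟨l₂, hl₂, hmax⟩ := hKc.exists_isMaxOn hK (continuous_apply j).continuousOn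
  refine ⟨l₁, l₂, fun lam hlam hi => ⟨hl₁.1, hl₂.1, ?_⟩⟩
  obtain ⟨hpos, hL⟩ := hnorm lam hlam hi
  set L := (∑ j, lam j)⁻¹ • lam with hLdef
  obtain ⟨s, t, hs, ht, hst, hj⟩ : L j ∈ segment ℝ (l₁ j) (l₂ j) := by
    have h1 : l₁ j ≤ L j := hmin hL
    have h2 : L j ≤ l₂ j := hmax hL
    rw [segment_eq_Icc (h1.trans h2)]
    exact ⟨h1, h2⟩
  simp only [smul_eq_mul] at hj
  have hcomb : L = s • l₁ + t • l₂ := by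
    have e := hL.2.2
    have e₁ := hl₁.2.2
    have e₂ := hl₂.2.2
    rw [hsum, hL.2.1] at e
    rw [hsum, hl₁.2.1] at e₁
    rw [hsum, hl₂.2.1] at e₂
    ext p
    simp only [Pi.add_apply, Pi.smul_apply, smul_eq_mul]
    rcases hcover p with rfl | rfl | rfl
    · rw [hL.2.1, hl₁.2.1, hl₂.2.1]; ring
    · exact hj.symm
    · linear_combination e - s * e₁ - t * e₂ + hj - hst
  intro x hx
  have hxL := Sagg_inter_subset hs ht hst hx
  rw [← hcomb, mem_Sagg_iff, hLdef, aggForm_smul] at hxL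
  exact mem_Sagg_iff.2 (neg_of_mul_neg_right hxL (inv_nonneg.2 hpos.le))

/-- A point outside the convex hull of `S` is cut off by an aggregation of `Ω` with a vanishing
weight. -/
lemma exists_facet_aggregation {n : ℕ} (hn : 3 ≤ n) {A : Fin 3 → Matrix (Fin n) (Fin n) ℝ}
    {b : Fin 3 → Fin n → ℝ} {c : Fin 3 → ℝ} (hA : ∀ i, (A i).IsSymm) {θ : Fin 3 → ℝ}
    (hθ : ∀ v, v ≠ 0 → 0 < aggForm A b c θ v v) (hS : (Sset A b c).Nonempty)
    {y : Fin n → ℝ} (hy : y ∉ convexHull ℝ (Sset A b c)) :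
    ∃ lam ∈ Omega A b c, (∃ i, lam i = 0) ∧ y ∉ Sagg A b c lam := by
  obtain ⟨f, hf⟩ := geometric_hahn_banach_open_point (convex_convexHull ℝ (Sset A b c))
    (isOpen_Sset A b c).convexHull hy
  set φ : (Fin n ⊕ Unit → ℝ) →ₗ[ℝ] ℝ := f.toLinearMap ∘ₗ LinearMap.funLeft ℝ ℝ Sum.inl
    - f y • LinearMap.proj (Sum.inr ()) with hφ
  have hφ_apply : ∀ v, φ v = f (v ∘ Sum.inl) - f y * v (Sum.inr ()) := fun v => rfl
  have hφ_homog : ∀ x, φ (homog x) = f x - f y := by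
    intro x; simp [hφ_apply, homog]
  have hφS : ∀ x ∈ Sset A b c, φ (homog x) < 0 := fun x hx => by
    rw [hφ_homog]; linarith [hf x (subset_convexHull ℝ _ hx)]
  have hφy : φ (homog y) = 0 := by rw [hφ_homog, sub_self]
  have hy0 : homog y ≠ 0 := fun h => by simpa [homog] using congrFun h (Sum.inr ())
  have hfin : 3 ≤ Module.finrank ℝ (LinearMap.ker φ) := by
    have h1 := φ.finrank_range_add_finrank_ker
    have h2 := (LinearMap.range φ).finrank_le
    simp at h1 h2
    omega
  set B : Fin 3 → LinearMap.BilinForm ℝ (Fin n ⊕ Unit → ℝ) := fun i =>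
    (Qmat (A i) (b i) (c i)).toBilin' with hB
  have haffine : ∀ v, φ v = 0 → v (Sum.inr ()) ≠ 0 → ¬ ∀ i, B i v v < 0 := by
    intro v hv ht hneg
    set t := v (Sum.inr ()) with ht_def
    have hvx : v = t • homog (t⁻¹ • (v ∘ Sum.inl)) := by
      ext p
      rcases p with p | p
      · simp [homog, ht]
      · simp [homog, ht_def]
    have hx : t⁻¹ • (v ∘ Sum.inl) ∈ Sset A b c := fun i => by
      have h := hneg i
      rw [hvx] at h
      simp only [map_smul, LinearMap.smul_apply, smul_eq_mul, hB, toBilin'_Qmat_homog] at h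
      rw [← mul_assoc] at h
      exact neg_of_mul_neg_right h (mul_self_nonneg _)
    have h := hφS _ hx
    rw [hvx, map_smul, smul_eq_mul] at hv
    exact (mul_ne_zero ht h.ne) hv
  have hneg : ∀ v, φ v = 0 → ¬ ∀ i, B i v v < 0 := by
    intro v hv hneg
    by_cases ht : v (Sum.inr ()) = 0
    · have hev : ∀ᶠ ε : ℝ in nhds 0, ∀ i, B i (v + ε • homog y) (v + ε • homog y) < 0 := by
        refine Filter.eventually_all.2 fun i => ?_
        have hc : Continuous fun ε : ℝ => B i (v + ε • homog y) (v + ε • homog y) := by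
          simp only [map_add, map_smul, LinearMap.add_apply, LinearMap.smul_apply, smul_eq_mul]
          fun_prop
        exact hc.continuousAt.eventually_lt continuousAt_const (by simpa using hneg i)
      obtain ⟨ε, hε, hε0⟩ :=
        ((hev.filter_mono nhdsWithin_le_nhds).and (self_mem_nhdsWithin (s := Set.Ioi 0))).exists
      refine haffine (v + ε • homog y) (by simp [hv, hφy]) ?_ hε
      simpa [ht, homog] using (Set.mem_Ioi.1 hε0).ne'
    · exact haffine v hv ht hneg
  obtain ⟨l, hl0, hlne, hl⟩ := exists_nonneg_aggregation hfin
    (fun i => (B i).restrict (LinearMap.ker φ))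
    (fun i u v => by
      have h := aggForm_comm (b := b) (c := c) (lam := Pi.single i 1) hA u v
      simpa [aggForm_apply, Pi.single_apply] using h)
    (θ := θ)
    (fun v hv => by
      have h := hθ v (by simpa using hv)
      rwa [aggForm_apply] at h)
    (fun v => hneg v v.2)
  have hl' : ∀ v, φ v = 0 → 0 ≤ aggForm A b c l v v := fun v hv => by
    rw [aggForm_apply]; exact hl ⟨v, hv⟩
  obtain ⟨s, hs, hls, i, hi⟩ : ∃ s : ℝ, 0 ≤ s ∧ 0 ≤ l + s • θ ∧ ∃ i, (l + s • θ) i = 0 := by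
    have hne : (Finset.univ.filter fun i => θ i < 0).Nonempty := by
      by_contra! h
      have hθ0 : ∀ i, 0 ≤ θ i := fun i => by
        by_contra! hi
        exact Finset.notMem_empty i (h ▸ by simpa using hi)
      obtain ⟨x, hx⟩ := hS
      have h1 := hθ (homog x) fun h => by simpa [homog] using congrFun h (Sum.inr ())
      rw [aggForm_apply] at h1
      refine h1.not_ge (Finset.sum_nonpos fun i _ => ?_)
      rw [toBilin'_Qmat_homog]
      exact mul_nonpos_of_nonneg_of_nonpos (hθ0 i) (hx i).le
    obtain ⟨i, hi, hmin⟩ := Finset.exists_min_image _ (fun i => l i / -θ i) hne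
    have hi' : θ i < 0 := by simpa using hi
    refine ⟨l i / -θ i, div_nonneg (hl0 i) (by linarith), fun j => ?_, i, ?_⟩
    · simp only [Pi.zero_apply, Pi.add_apply, Pi.smul_apply, smul_eq_mul]
      rcases le_or_gt 0 (θ j) with hj | hj
      · exact add_nonneg (hl0 j) (mul_nonneg (div_nonneg (hl0 i) (by linarith)) hj)
      · have h1 := hmin j (by simpa using hj)
        rw [le_div_iff₀ (by linarith)] at h1
        linarith
    · simp only [Pi.add_apply, Pi.smul_apply, smul_eq_mul]
      rw [div_neg, neg_mul, div_mul_cancel₀ _ hi'.ne, add_neg_cancel]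
  have hadd : ∀ v, aggForm A b c (l + s • θ) v v
      = aggForm A b c l v v + s * aggForm A b c θ v v := by
    intro v
    simp [aggForm_apply, add_mul, Finset.sum_add_distrib, Finset.mul_sum, mul_assoc]
  have hpos : ∀ v, φ v = 0 → 0 ≤ aggForm A b c (l + s • θ) v v := by
    intro v hv
    rw [hadd]
    rcases eq_or_ne v 0 with rfl | h0
    · simp
    · exact add_nonneg (hl' v hv) (mul_nonneg hs (hθ v h0).le)
  have hne : l + s • θ ≠ 0 := by
    intro h
    rcases hs.eq_or_lt with rfl | hs
    · exact hlne (by simpa using h)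
    · have h1 := hadd (homog y)
      rw [h] at h1
      have h2 : aggForm A b c 0 (homog y) (homog y) = 0 := by simp [aggForm_apply]
      linarith [hl' _ hφy, mul_pos hs (hθ _ hy0)]
  exact ⟨l + s • θ, mem_Omega_of_hyperplane hA hls hne hφS hpos, ⟨i, hi⟩,
    fun h => (hpos _ hφy).not_gt (mem_Sagg_iff.1 h)⟩

/-- For three quadratics satisfying PDLC, at most six good aggregations describe the
convex hull. -/
theorem statement2 (n : ℕ) (hn : 3 ≤ n)
    (A : Fin 3 → Matrix (Fin n) (Fin n) ℝ) (b : Fin 3 → Fin n → ℝ) (c : Fin 3 → ℝ)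
    (hsymm : ∀ i, (A i).IsSymm)
    (hPDLC : ∃ θ : Fin 3 → ℝ, (∑ i, θ i • Qmat (A i) (b i) (c i)).PosDef)
    (hS : (Sset A b c).Nonempty)
    (hconv : convexHull ℝ (Sset A b c) ≠ Set.univ) :
    ∃ Ω' : Set (Fin 3 → ℝ), Ω' ⊆ Omega A b c ∧ Ω'.Finite ∧ Ω'.ncard ≤ 6 ∧
      convexHull ℝ (Sset A b c) = ⋂ lam ∈ Ω', Sagg A b c lam := by
  classical
  obtain ⟨θ, hθ⟩ := hPDLC
  have hθ' : ∀ v, v ≠ 0 → 0 < aggForm A b c θ v v := fun v hv => by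
    rw [aggForm, toBilin'_apply']
    simpa using hθ.dotProduct_mulVec_pos hv
  choose l₁ l₂ hl using exists_pair_dominating_facet (b := b) (c := c) hsymm
  set F : Finset (Fin 3 → ℝ) := Finset.univ.image l₁ ∪ Finset.univ.image l₂ with hF
  have hFcard : F.card ≤ 6 := (Finset.card_union_le _ _).trans
    (Nat.add_le_add (b := 3) (d := 3) Finset.card_image_le Finset.card_image_le)
  refine ⟨Omega A b c ∩ F, Set.inter_subset_left, F.finite_toSet.inter_of_right _, ?_, ?_⟩
  · refine (Set.ncard_le_ncard Set.inter_subset_right F.finite_toSet).trans ?_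
    rwa [Set.ncard_coe_finset]
  · refine Set.Subset.antisymm (Set.subset_iInter₂ fun lam hlam => hlam.1.2.2.1) fun y hy => ?_
    by_contra hy'
    obtain ⟨lam, hlam, ⟨i, hi⟩, hylam⟩ := exists_facet_aggregation hn hsymm hθ' hS hy'
    obtain ⟨h1, h2, hsub⟩ := hl i lam hlam hi
    rw [Set.mem_iInter₂] at hy
    exact hylam (hsub ⟨hy _ ⟨h1, by simp [hF]⟩, hy _ ⟨h2, by simp [hF]⟩⟩)

end
end

section
/- Let f_1,…,f_m be quadratic functions f_i(x) = xᵀA_ix + 2b_iᵀx + c_i on ℝⁿ such that the image of the associated homogeneous quadratic map f^h = (f_1^h,…,f_m^h) : ℝ^{n+1} → ℝᵐ is a convex subset of ℝᵐ. Then S = {x ∈ ℝⁿ : f_i(x) < 0 for all i ∈ [m]} is empty if and only if Q_λ = Σᵢ λ_iQ_i is positive semidefinite for some nonzero λ ∈ ℝᵐ with λ ≥ 0. -/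
open Matrix Set

noncomputable section

theorem Qmat_quadForm_elim {n : ℕ} (A : Matrix (Fin n) (Fin n) ℝ) (b : Fin n → ℝ) (c : ℝ)
    (x : Fin n → ℝ) (t : ℝ) :
    Sum.elim x (fun _ => t) ⬝ᵥ (Qmat A b c).mulVec (Sum.elim x fun _ => t) =
      x ⬝ᵥ A.mulVec x + 2 * t * (b ⬝ᵥ x) + c * t ^ 2 := by
  have h₁ : (Matrix.of fun i (_ : Unit) => b i).mulVec (fun _ => t) = t • b := by
    ext i
    simp [mulVec, dotProduct, mul_comm]
  have h₂ : (Matrix.of fun (_ : Unit) j => b j).mulVec x = fun _ => b ⬝ᵥ x := by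
    ext i
    simp [mulVec]
  have h₃ : (Matrix.of fun (_ _ : Unit) => c).mulVec (fun _ => t) = fun _ => c * t := by
    ext i
    simp [mulVec, dotProduct]
  rw [Qmat, fromBlocks_mulVec]
  simp only [Sum.elim_comp_inl, Sum.elim_comp_inr, h₁, h₂, h₃, sumElim_dotProduct_sumElim,
    dotProduct_add, dotProduct_smul, smul_eq_mul, dotProduct_comm x b]
  simp [dotProduct]
  ring

theorem qf_eq_Qmat_quadForm {n : ℕ} (A : Matrix (Fin n) (Fin n) ℝ) (b : Fin n → ℝ) (c : ℝ)
    (x : Fin n → ℝ) :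
    qf A b c x =
      Sum.elim x (fun _ => 1) ⬝ᵥ (Qmat A b c).mulVec (Sum.elim x fun _ => 1) := by
  rw [Qmat_quadForm_elim, qf]
  ring

theorem Qmat_isSymm {n : ℕ} {A : Matrix (Fin n) (Fin n) ℝ} (hA : A.IsSymm) (b : Fin n → ℝ)
    (c : ℝ) : (Qmat A b c).IsSymm :=
  IsSymm.fromBlocks hA rfl rfl

theorem quadForm_sum_smul {ι κ : Type*} [Fintype ι] [Fintype κ] (Q : κ → Matrix ι ι ℝ)
    (lam : κ → ℝ) (v : ι → ℝ) :
    v ⬝ᵥ (∑ i, lam i • Q i).mulVec v = ∑ i, lam i * (v ⬝ᵥ (Q i).mulVec v) := by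
  simp only [sum_mulVec, dotProduct_sum, smul_mulVec, dotProduct_smul, smul_eq_mul]

theorem quadForm_smul {ι : Type*} [Fintype ι] (Q : Matrix ι ι ℝ) (s : ℝ) (v : ι → ℝ) :
    (s • v) ⬝ᵥ Q.mulVec (s • v) = s ^ 2 * (v ⬝ᵥ Q.mulVec v) := by
  simp only [mulVec_smul, dotProduct_smul, smul_dotProduct, smul_eq_mul]
  ring

/-- A common negative vector of the homogenized forms can be moved off the hyperplane at
infinity, and then yields a point of `S`. -/
theorem Sset_nonempty_of_homogeneous_neg {n m : ℕ} {A : Fin m → Matrix (Fin n) (Fin n) ℝ}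
    {b : Fin m → Fin n → ℝ} {c : Fin m → ℝ} {v : Fin n ⊕ Unit → ℝ}
    (hv : ∀ i, v ⬝ᵥ (Qmat (A i) (b i) (c i)).mulVec v < 0) : (Sset A b c).Nonempty := by
  obtain ⟨x, t, rfl⟩ : ∃ (x : Fin n → ℝ) (t : ℝ), v = Sum.elim x fun _ => t :=
    ⟨v ∘ Sum.inl, v (Sum.inr ()), by ext (i | i) <;> rfl⟩
  simp only [Qmat_quadForm_elim] at hv
  have hopen : IsOpen {s : ℝ | ∀ i,
      x ⬝ᵥ (A i).mulVec x + 2 * s * (b i ⬝ᵥ x) + c i * s ^ 2 < 0} := by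
    simp only [ofPred_forall]
    exact isOpen_iInter_of_finite fun i => isOpen_lt (by fun_prop) continuous_const
  obtain ⟨s, hs0, hs⟩ := (dense_compl_singleton (0 : ℝ)).exists_mem_open hopen ⟨t, hv⟩
  have hs0 : s ≠ 0 := hs0
  refine ⟨s⁻¹ • x, fun i => ?_⟩
  have hscale : (Sum.elim (s⁻¹ • x) fun _ => 1 : Fin n ⊕ Unit → ℝ) =
      s⁻¹ • Sum.elim x fun _ => s := by
    ext (j | j) <;> simp [hs0]
  rw [qf_eq_Qmat_quadForm, hscale, quadForm_smul, Qmat_quadForm_elim]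
  exact mul_neg_of_pos_of_neg (by positivity) (hs i)

/-- A convex set closed under squared scaling and missing the open negative orthant admits a
nonzero nonnegative linear functional that is nonnegative on it. -/
theorem exists_nonneg_functional_of_disjoint_neg_orthant {κ : Type*} [Fintype κ]
    {C : Set (κ → ℝ)} (hC : Convex ℝ C) (hne : C.Nonempty)
    (hscale : ∀ s : ℝ, ∀ y ∈ C, s ^ 2 • y ∈ C)
    (hdisj : ∀ y ∈ C, ¬ ∀ i, y i < 0) :
    ∃ lam : κ → ℝ, 0 ≤ lam ∧ lam ≠ 0 ∧ ∀ y ∈ C, 0 ≤ ∑ i, lam i * y i := by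
  classical
  have hopen : IsOpen {y : κ → ℝ | ∀ i, y i < 0} := by
    simp only [ofPred_forall]
    exact isOpen_iInter_of_finite fun i => isOpen_lt (by fun_prop) continuous_const
  have hconv : Convex ℝ {y : κ → ℝ | ∀ i, y i < 0} := by
    simp only [ofPred_forall]
    exact convex_iInter fun i => convex_halfSpace_lt (LinearMap.proj (R := ℝ) i).isLinear 0
  obtain ⟨f, u, hneg, hfC⟩ := geometric_hahn_banach_open hconv hopen hC
    (Set.disjoint_left.2 fun y hy hyC => hdisj y hyC hy)
  have hu : u ≤ 0 := by
    obtain ⟨y, hy⟩ := hne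
    simpa using hfC _ (hscale 0 y hy)
  have hf : ∀ y, f y = ∑ i, f (Pi.single i 1) * y i := fun y => by
    conv_lhs => rw [pi_eq_sum_univ' y]
    simp [map_sum, mul_comm]
  refine ⟨fun i => f (Pi.single i 1), fun i => ?_, fun h0 => ?_, fun y hy => ?_⟩
  · by_contra! hi
    have hi : f (Pi.single i 1) < 0 := hi
    have hone : f (fun _ => -1) < 0 := (hneg _ fun _ => by norm_num).trans_le hu
    have key : 0 < f (fun _ => -1) / f (Pi.single i 1) := div_pos_of_neg_of_neg hone hi
    have := hneg ((fun _ => -1) - (f (fun _ => -1) / f (Pi.single i 1)) • Pi.single i 1)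
      fun j => by
        have : 0 ≤ (Pi.single i 1 : κ → ℝ) j := by
          by_cases h : j = i <;> simp [h]
        simp only [Pi.sub_apply, Pi.smul_apply, smul_eq_mul]
        nlinarith [mul_nonneg key.le this]
    rw [map_sub, map_smul, smul_eq_mul, div_mul_cancel₀ _ hi.ne, sub_self] at this
    linarith
  · have := hneg (fun _ => -1) fun _ => by norm_num
    rw [hf, Finset.sum_eq_zero fun i _ => by rw [congrFun h0 i]; simp] at this
    linarith
  · rw [← hf]
    by_contra! hlt
    obtain ⟨s, hs⟩ : ∃ s : ℝ, (u - 1) / f y ≤ s ^ 2 :=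
      ⟨√((u - 1) / f y), (Real.sq_sqrt (div_nonneg_of_nonpos (by linarith) hlt.le)).ge⟩
    have := hfC _ (hscale s y hy)
    rw [div_le_iff_of_neg hlt] at hs
    rw [map_smul, smul_eq_mul] at this
    linarith

/-- Hidden convexity of the homogeneous quadratic map certifies emptiness of `S` via
aggregations: `S = ∅` iff some nonnegative nonzero combination `Q_λ` is PSD. -/
theorem statement6 (n m : ℕ)
    (A : Fin m → Matrix (Fin n) (Fin n) ℝ) (b : Fin m → Fin n → ℝ) (c : Fin m → ℝ)
    (hsymm : ∀ i, (A i).IsSymm)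
    (hconv : Convex ℝ (quadImage (fun i => Qmat (A i) (b i) (c i)) Set.univ)) :
    Sset A b c = ∅ ↔ ∃ lam : Fin m → ℝ, 0 ≤ lam ∧ lam ≠ 0 ∧
      (∑ i, lam i • Qmat (A i) (b i) (c i)).PosSemidef := by
  constructor
  · intro hS
    obtain ⟨lam, hlam, hlam0, hnn⟩ := exists_nonneg_functional_of_disjoint_neg_orthant hconv
      (univ_nonempty.image _)
      (by
        rintro s _ ⟨v, -, rfl⟩
        exact ⟨s • v, mem_univ _, funext fun i => quadForm_smul _ s v⟩)
      (by
        rintro _ ⟨v, -, rfl⟩ hv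
        exact (Sset_nonempty_of_homogeneous_neg hv).ne_empty hS)
    refine ⟨lam, hlam, hlam0, PosSemidef.of_dotProduct_mulVec_nonneg ?_ fun v => ?_⟩
    · simp only [IsHermitian, conjTranspose_eq_transpose_of_trivial, transpose_sum,
        transpose_smul, fun i => (Qmat_isSymm (hsymm i) (b i) (c i)).eq]
    · rw [star_trivial, quadForm_sum_smul]
      exact hnn _ ⟨v, mem_univ _, rfl⟩
  · rintro ⟨lam, hlam, hlam0, hpsd⟩
    refine eq_empty_of_forall_notMem fun x hx => ?_
    have hnn := hpsd.dotProduct_mulVec_nonneg (Sum.elim x fun _ => 1)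
    rw [star_trivial, quadForm_sum_smul] at hnn
    simp only [← qf_eq_Qmat_quadForm] at hnn
    obtain ⟨i, hi⟩ := Function.ne_iff.1 hlam0
    exact hnn.not_gt <| Finset.sum_neg'
      (fun j _ => mul_nonpos_of_nonneg_of_nonpos (hlam j) (hx j).le)
      ⟨i, Finset.mem_univ i, mul_neg_of_pos_of_neg ((hlam i).lt_of_ne' hi) (hx i)⟩

end
end
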